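/- Suppose Y = Xβ⁰ + ε with ε ~ N_n(0, σ₀²I). Let β̂ be any estimator, Γ̂_J the multivariate square-root Lasso for regressing X_J on X_{-J} with tuning parameter λ, and define T̃_J := (X_J − X_{-J}Γ̂_J)ᵀX_J/n, T̂_J := (X_J − X_{-J}Γ̂_J)ᵀ(X_J − X_{-J}Γ̂_J)/n (assumed nonsingular), M := √n T̂_J^{-1/2} T̃_J, and the de-sparsified estimator b̂_J := β̂_J + T̃_J^{-1}(X_J − X_{-J}Γ̂_J)ᵀ(Y − Xβ̂)/n. Then M(b̂_J − β⁰_J)/σ₀ = Z + rem, where Z ~ N_{|J|}(0, I) and ‖rem‖_∞ ≤ √n λ ‖β̂_{-J} − β⁰_{-J}‖₁/σ₀. -/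

import Mathlib

open Matrix MeasureTheory ProbabilityTheory BigOperators

lemma gauss_linear {n q : ℕ} (v : NNReal) (A : Matrix (Fin q) (Fin n) ℝ)
    (hA : (v : ℝ) • (A * Aᵀ) = 1) :
    Measure.map (fun x : Fin n → ℝ => A *ᵥ x)
      (Measure.pi fun _ : Fin n => gaussianReal 0 v) =
      Measure.pi fun _ : Fin q => gaussianReal 0 1 := by
  have hm : Measurable (fun x : Fin n → ℝ => A *ᵥ x) :=
    Continuous.measurable (by fun_prop)
  have : IsProbabilityMeasure (Measure.map (fun x : Fin n → ℝ => A *ᵥ x)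
      (Measure.pi fun _ : Fin n => gaussianReal 0 v)) :=
    Measure.isProbabilityMeasure_map hm.aemeasurable
  rw [← charFun_eq_pi_iff]
  intro t
  have h1 : charFun ((Measure.map (fun x : Fin n → ℝ => A *ᵥ x)
      (Measure.pi fun _ : Fin n => gaussianReal 0 v)).map (WithLp.toLp 2)) t =
      charFun ((Measure.pi fun _ : Fin n => gaussianReal 0 v).map (WithLp.toLp 2))
        (WithLp.toLp 2 (Aᵀ *ᵥ t.ofLp)) := by
    rw [charFun_apply, charFun_apply, integral_map (by fun_prop) (by fun_prop),
      integral_map (by fun_prop) (by fun_prop), integral_map (by fun_prop) (by fun_prop)]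
    congr with x
    congr 3
    simp only [EuclideanSpace.inner_eq_star_dotProduct, star_trivial]
    rw [dotProduct_mulVec, mulVec_transpose]
  rw [h1, charFun_pi]
  simp_rw [charFun_gaussianReal, ← Complex.exp_sum]
  congr 1
  have h2 : (v : ℝ) * ∑ i, (Aᵀ *ᵥ t.ofLp) i ^ 2 = ∑ i, t i ^ 2 := by
    have : (v : ℝ) * ((Aᵀ *ᵥ t.ofLp) ⬝ᵥ (Aᵀ *ᵥ t.ofLp)) = t.ofLp ⬝ᵥ t.ofLp := by
      rw [dotProduct_mulVec, vecMul_transpose, mulVec_mulVec, ← smul_eq_mul, ← smul_dotProduct,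
        ← smul_mulVec, hA, one_mulVec]
    simpa [dotProduct, pow_two] using this
  have h3 := congrArg (fun r : ℝ => (r : ℂ)) h2
  push_cast at h3
  simp only [Complex.ofReal_zero, mul_zero, zero_mul, zero_sub, Finset.sum_neg_distrib,
    ← Finset.sum_div, ← Finset.mul_sum, NNReal.coe_one, Complex.ofReal_one, one_mul]
  rw [h3]

/-- Main theorem: with `Y = Xβ⁰ + ε`, `ε ~ N_n(0, σ₀²I)`, `Γ̂_J` the multivariate
square-root Lasso of `X_J` on `X_{-J}` (encoded via its KKT conditions
`X_{-J}ᵀ(X_J − X_{-J}Γ̂_J)T̂_J^{-1/2}/n = λẐ_J`, `‖Ẑ_J‖_∞ ≤ 1`), `W := T̂_J^{-1/2}`,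
`T̃_J := (X_J − X_{-J}Γ̂_J)ᵀX_J/n`, `M := √n W T̃_J` and the de-sparsified estimator
`b̂_J := β̂_J + T̃_J^{-1}(X_J − X_{-J}Γ̂_J)ᵀ(Y − Xβ̂)/n`, one has
`M(b̂_J − β⁰_J)/σ₀ = Z + rem` with `Z ~ N_{|J|}(0, I)` and
`‖rem‖_∞ ≤ √n λ ‖β̂_{-J} − β⁰_{-J}‖₁/σ₀`.
Coordinates are split into the `q = |J|` coordinates in `J` and `m = p − |J|` others. -/
theorem stmt_3 {n q m : ℕ} (hn : 0 < n)
    (XJ : Matrix (Fin n) (Fin q) ℝ) (XmJ : Matrix (Fin n) (Fin m) ℝ)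
    (βJ0 : Fin q → ℝ) (βmJ0 : Fin m → ℝ)
    (σ₀ : ℝ) (hσ₀ : 0 < σ₀) (lam : ℝ) (hlam : 0 < lam)
    (Γ : Matrix (Fin m) (Fin q) ℝ)
    (W : Matrix (Fin q) (Fin q) ℝ) (hWsymm : Wᵀ = W)
    (hW : W * ((1 / (n : ℝ)) • ((XJ - XmJ * Γ)ᵀ * (XJ - XmJ * Γ))) * W = 1)
    (hT : IsUnit ((1 / (n : ℝ)) • ((XJ - XmJ * Γ)ᵀ * XJ)).det)
    (Zhat : Matrix (Fin m) (Fin q) ℝ) (hZhat : ∀ k j, |Zhat k j| ≤ 1)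
    (hKKT : (1 / (n : ℝ)) • (XmJᵀ * (XJ - XmJ * Γ) * W) = lam • Zhat)
    {Ω : Type*} [MeasurableSpace Ω] (μ : Measure Ω) [IsProbabilityMeasure μ]
    (ε : Ω → Fin n → ℝ) (hεmeas : Measurable ε)
    (hεlaw : Measure.map ε μ =
      Measure.pi fun _ : Fin n => gaussianReal 0 (Real.toNNReal (σ₀ ^ 2)))
    (Y : Ω → Fin n → ℝ) (hY : ∀ ω, Y ω = XJ *ᵥ βJ0 + XmJ *ᵥ βmJ0 + ε ω)
    (βhatJ : Ω → Fin q → ℝ) (βhatmJ : Ω → Fin m → ℝ) :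
    ∃ Z rem : Ω → Fin q → ℝ,
      Measure.map Z μ = (Measure.pi fun _ : Fin q => gaussianReal 0 1) ∧
      (∀ ω, σ₀⁻¹ •
          ((Real.sqrt n • (W * ((1 / (n : ℝ)) • ((XJ - XmJ * Γ)ᵀ * XJ)))) *ᵥ
            ((βhatJ ω + ((1 / (n : ℝ)) • ((XJ - XmJ * Γ)ᵀ * XJ))⁻¹ *ᵥ
              ((1 / (n : ℝ)) • ((XJ - XmJ * Γ)ᵀ *ᵥ
                (Y ω - XJ *ᵥ βhatJ ω - XmJ *ᵥ βhatmJ ω)))) - βJ0)) =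
        Z ω + rem ω) ∧
      (∀ ω j, |rem ω j| ≤
        Real.sqrt n * lam * (∑ k, |βhatmJ ω k - βmJ0 k|) / σ₀) := by
  have hn0 : (n : ℝ) ≠ 0 := by positivity
  set R := XJ - XmJ * Γ with hR
  set T := (1 / (n : ℝ)) • (Rᵀ * XJ) with hTdef
  have hK2 : (1 / (n : ℝ)) • (W * Rᵀ * XmJ) = lam • Zhatᵀ := by
    have := congrArg Matrix.transpose hKKT
    simpa [Matrix.transpose_mul, hWsymm, Matrix.mul_assoc] using this
  refine ⟨fun ω => (σ₀⁻¹ • Real.sqrt n • (1 / (n : ℝ)) • (W * Rᵀ)) *ᵥ ε ω,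
    fun ω => -((σ₀⁻¹ * Real.sqrt n * lam) • (Zhatᵀ *ᵥ (βhatmJ ω - βmJ0))), ?_, ?_, ?_⟩
  · have hm : Measurable (fun x : Fin n → ℝ =>
        (σ₀⁻¹ • Real.sqrt n • (1 / (n : ℝ)) • (W * Rᵀ)) *ᵥ x) :=
      Continuous.measurable (by fun_prop)
    have := gauss_linear (Real.toNNReal (σ₀ ^ 2))
      (σ₀⁻¹ • Real.sqrt n • (1 / (n : ℝ)) • (W * Rᵀ)) ?_
    · rw [← this, ← hεlaw, Measure.map_map hm hεmeas]
      rfl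
    · rw [← hW, Real.coe_toNNReal _ (sq_nonneg _)]
      simp only [Matrix.transpose_smul, Matrix.transpose_mul, Matrix.transpose_transpose, hWsymm,
        Matrix.smul_mul, Matrix.mul_smul, smul_smul, Matrix.mul_assoc]
      congr 1
      have := Real.mul_self_sqrt (Nat.cast_nonneg (α := ℝ) n)
      field_simp
      nlinarith
  · intro ω
    have e1 : Y ω - XJ *ᵥ βhatJ ω - XmJ *ᵥ βhatmJ ω =
        ε ω - XJ *ᵥ (βhatJ ω - βJ0) - XmJ *ᵥ (βhatmJ ω - βmJ0) := by
      rw [hY, mulVec_sub, mulVec_sub]; abel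
    have e2 : (1 / (n : ℝ)) • (Rᵀ *ᵥ (Y ω - XJ *ᵥ βhatJ ω - XmJ *ᵥ βhatmJ ω)) =
        (1 / (n : ℝ)) • (Rᵀ *ᵥ ε ω) - T *ᵥ (βhatJ ω - βJ0) -
          (1 / (n : ℝ)) • ((Rᵀ * XmJ) *ᵥ (βhatmJ ω - βmJ0)) := by
      rw [e1, hTdef, mulVec_sub, mulVec_sub, mulVec_mulVec, mulVec_mulVec, smul_sub, smul_sub,
        smul_mulVec]
    have e3 : T *ᵥ (βhatJ ω + T⁻¹ *ᵥ
        ((1 / (n : ℝ)) • (Rᵀ *ᵥ (Y ω - XJ *ᵥ βhatJ ω - XmJ *ᵥ βhatmJ ω))) - βJ0) =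
        (1 / (n : ℝ)) • (Rᵀ *ᵥ ε ω) -
          (1 / (n : ℝ)) • ((Rᵀ * XmJ) *ᵥ (βhatmJ ω - βmJ0)) := by
      rw [mulVec_sub, mulVec_add, mulVec_mulVec, Matrix.mul_nonsing_inv _ hT, one_mulVec, e2,
        mulVec_sub]
      abel
    have e4 : (1 / (n : ℝ)) • (W *ᵥ ((Rᵀ * XmJ) *ᵥ (βhatmJ ω - βmJ0))) =
        lam • (Zhatᵀ *ᵥ (βhatmJ ω - βmJ0)) := by
      rw [mulVec_mulVec, ← Matrix.mul_assoc, ← smul_mulVec, hK2, smul_mulVec]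
    rw [smul_mulVec, ← mulVec_mulVec, e3, mulVec_sub, mulVec_smul, mulVec_smul, e4,
      smul_sub, smul_sub, mulVec_mulVec, sub_eq_add_neg]
    simp only [smul_mulVec, smul_smul, mul_assoc]
  · intro ω j
    have hb : |(Zhatᵀ *ᵥ (βhatmJ ω - βmJ0)) j| ≤ ∑ k, |βhatmJ ω k - βmJ0 k| := by
      rw [mulVec, dotProduct]
      refine (Finset.abs_sum_le_sum_abs _ _).trans (Finset.sum_le_sum fun k _ => ?_)
      rw [abs_mul]
      exact mul_le_of_le_one_left (abs_nonneg _) (hZhat k j)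
    have hc : 0 ≤ σ₀⁻¹ * Real.sqrt n * lam := by positivity
    simp only [Pi.neg_apply, Pi.smul_apply, smul_eq_mul, abs_neg, abs_mul _ ((Zhatᵀ *ᵥ _) j),
      abs_of_nonneg hc]
    refine (mul_le_mul_of_nonneg_left hb hc).trans (le_of_eq ?_)
    rw [div_eq_mul_inv]; ring
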